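/- Let G be a finite simple graph, k a positive integer, and e = xy an edge of G. If γ_{P,k}(G/e) = γ_{P,k}(G) + 1, then rad_{P,k}(G/e) ≤ rad_{P,k}(G), where G/e is the contraction of the edge e in G. -/

import Mathlib

open SimpleGraph

variable {V : Type*}

/-- The closed neighbourhood `N_G[v]` of a vertex. -/
def closedNbhd (G : SimpleGraph V) (v : V) : Set V := insert v (G.neighborSet v)

/-- The closed neighbourhood `N_G[X]` of a set of vertices. -/
def closedNbhdSet (G : SimpleGraph V) (X : Set V) : Set V := ⋃ v ∈ X, closedNbhd G v

/-- The sets `P^i_{G,k}(S)` of vertices monitored by `S` at step `i`. -/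
def monitored (G : SimpleGraph V) (k : ℕ) (S : Set V) : ℕ → Set V
  | 0 => closedNbhdSet G S
  | i + 1 =>
      ⋃ v ∈ {w | w ∈ monitored G k S i ∧ (closedNbhd G w \ monitored G k S i).ncard ≤ k},
        closedNbhd G v

/-- `S` is a `k`-power dominating set of `G`. -/
def IsPDS (G : SimpleGraph V) (k : ℕ) (S : Set V) : Prop :=
  ∃ i, monitored G k S i = Set.univ

/-- The `k`-power domination number `γ_{P,k}(G)`. -/
noncomputable def pdn (G : SimpleGraph V) (k : ℕ) : ℕ :=
  sInf {n | ∃ S : Set V, IsPDS G k S ∧ S.ncard = n}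

/-- The radius `rad_{P,k}(G,S)` of a `k`-PDS `S`. -/
noncomputable def radPDS (G : SimpleGraph V) (k : ℕ) (S : Set V) : ℕ :=
  1 + sInf {i | monitored G k S i = Set.univ}

/-- The `k`-propagation radius `rad_{P,k}(G)`. -/
noncomputable def propRad (G : SimpleGraph V) (k : ℕ) : ℕ :=
  sInf {r | ∃ S : Set V, IsPDS G k S ∧ S.ncard = pdn G k ∧ radPDS G k S = r}

/-- The contraction `G/e` of the edge `e = xy`: delete `x` and `y` and replace them by a
new vertex (represented by `x`) adjacent to all vertices in `(N_G(x) ∪ N_G(y)) \ {x, y}`. -/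
def contractEdge (G : SimpleGraph V) (x y : V) : SimpleGraph {u : V // u ≠ y} :=
  SimpleGraph.fromRel (fun a b =>
    ((a : V) = x ∧ (G.Adj x b ∨ G.Adj y b)) ∨ ((a : V) ≠ x ∧ (b : V) ≠ x ∧ G.Adj a b))

theorem self_mem_closedNbhd {V : Type*} (G : SimpleGraph V) (v : V) : v ∈ closedNbhd G v :=
  Set.mem_insert _ _

theorem monitored_subset_succ {V : Type*} [Finite V] (G : SimpleGraph V) (k : ℕ) (S : Set V)
    (i : ℕ) : monitored G k S i ⊆ monitored G k S (i + 1) := by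
  induction i with
  | zero =>
    intro w hw
    simp only [monitored, closedNbhdSet, Set.mem_iUnion, exists_prop] at hw
    obtain ⟨v, hv, hwv⟩ := hw
    have hsub : closedNbhd G v ⊆ monitored G k S 0 :=
      Set.subset_biUnion_of_mem (u := closedNbhd G) hv
    refine Set.mem_biUnion (x := v) ⟨hsub (self_mem_closedNbhd G v), ?_⟩ hwv
    simp [Set.sdiff_eq_empty.2 hsub]
  | succ i ih =>
    intro w hw
    obtain ⟨v, ⟨hv, hc⟩, hwv⟩ := Set.mem_iUnion₂.1 hw
    exact Set.mem_biUnion (x := v) ⟨ih hv, (Set.ncard_le_ncard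
      (Set.sdiff_subset_sdiff_right ih) (Set.toFinite _)).trans hc⟩ hwv

theorem monitored_mono {V : Type*} [Finite V] (G : SimpleGraph V) (k : ℕ) (S : Set V) :
    Monotone (monitored G k S) :=
  monotone_nat_of_le_succ (monitored_subset_succ G k S)

theorem isPDS_univ {V : Type*} (G : SimpleGraph V) (k : ℕ) : IsPDS G k Set.univ :=
  ⟨0, Set.eq_univ_of_forall fun v => Set.mem_biUnion (Set.mem_univ v) (self_mem_closedNbhd G v)⟩

theorem pdn_le_ncard {V : Type*} {G : SimpleGraph V} {k : ℕ} {S : Set V} (hS : IsPDS G k S) :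
    pdn G k ≤ S.ncard :=
  Nat.sInf_le ⟨S, hS, rfl⟩

theorem exists_isPDS_radPDS_eq_propRad {V : Type*} (G : SimpleGraph V) (k : ℕ) :
    ∃ S : Set V, IsPDS G k S ∧ S.ncard = pdn G k ∧ radPDS G k S = propRad G k := by
  obtain ⟨S, hS, hc⟩ : pdn G k ∈ {n | ∃ S : Set V, IsPDS G k S ∧ S.ncard = n} :=
    Nat.sInf_mem ⟨_, Set.univ, isPDS_univ G k, rfl⟩
  exact Nat.sInf_mem
    (s := {r | ∃ S : Set V, IsPDS G k S ∧ S.ncard = pdn G k ∧ radPDS G k S = r})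
    ⟨_, S, hS, hc, rfl⟩

/-- The quotient map from the vertices of `G` to those of the contraction of the edge `xy`. -/
def contractMap {V : Type*} [DecidableEq V] {x y : V} (hne : x ≠ y) (v : V) : {u : V // u ≠ y} :=
  if hv : v = y then ⟨x, hne⟩ else ⟨v, hv⟩

theorem contractMap_of_ne {V : Type*} [DecidableEq V] {x y : V} (hne : x ≠ y) {v : V}
    (hv : v ≠ y) : contractMap hne v = ⟨v, hv⟩ :=
  dif_neg hv

theorem contractMap_mem_closedNbhd {V : Type*} [DecidableEq V] (G : SimpleGraph V) {x y : V}
    (hne : x ≠ y) {v w : V} (hw : w ∈ closedNbhd G v) :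
    contractMap hne w ∈ closedNbhd (contractEdge G x y) (contractMap hne v) := by
  rcases hw with rfl | hw
  · exact self_mem_closedNbhd _ _
  · rw [SimpleGraph.mem_neighborSet] at hw
    have hs := hw.symm
    by_cases he : contractMap hne w = contractMap hne v
    · rw [he]
      exact self_mem_closedNbhd _ _
    · right
      rw [SimpleGraph.mem_neighborSet, contractEdge, SimpleGraph.fromRel_adj]
      refine ⟨fun h => he h.symm, ?_⟩
      unfold contractMap at he ⊢
      grind

theorem contractMap_image_monitored_subset {V : Type*} [Finite V] [DecidableEq V]
    (G : SimpleGraph V) (k : ℕ) {x y : V} (hne : x ≠ y) (S : Set V) (i : ℕ) :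
    contractMap hne '' monitored G k S i ⊆
      monitored (contractEdge G x y) k (insert ⟨x, hne⟩ (contractMap hne '' S)) i := by
  set T := insert (⟨x, hne⟩ : {u : V // u ≠ y}) (contractMap hne '' S) with hT
  have hX : ∀ j, closedNbhd (contractEdge G x y) ⟨x, hne⟩ ⊆
      monitored (contractEdge G x y) k T j := fun j =>
    (Set.subset_biUnion_of_mem (u := closedNbhd (contractEdge G x y))
      (Set.mem_insert _ _ : _ ∈ T)).trans (monitored_mono _ k T (Nat.zero_le j))
  induction i with
  | zero =>
    rintro _ ⟨w, hw, rfl⟩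
    obtain ⟨v, hv, hwv⟩ := Set.mem_iUnion₂.1 hw
    exact Set.mem_biUnion (Set.mem_insert_of_mem _ ⟨v, hv, rfl⟩)
      (contractMap_mem_closedNbhd G hne hwv)
  | succ i ih =>
    rintro _ ⟨w, hw, rfl⟩
    obtain ⟨v, ⟨hv, hc⟩, hwv⟩ := Set.mem_iUnion₂.1 hw
    have hwv' := contractMap_mem_closedNbhd G hne hwv
    by_cases hvX : contractMap hne v = ⟨x, hne⟩
    · rw [hvX] at hwv'
      exact hX _ hwv'
    refine Set.mem_biUnion ⟨ih ⟨v, hv, rfl⟩, le_trans ?_ hc⟩ hwv'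
    have hvy : v ≠ y := fun e => hvX (dif_pos e)
    have hvx : v ≠ x := by
      rintro rfl
      exact hvX (contractMap_of_ne hne hvy)
    refine (Set.ncard_le_ncard (t := contractMap hne '' (closedNbhd G v \ monitored G k S i))
      ?_ (Set.toFinite _)).trans (Set.ncard_image_le (Set.toFinite _))
    rintro ⟨u, hu⟩ ⟨huN, huP⟩
    have hux : u ≠ x := by
      rintro rfl
      exact huP (hX i (self_mem_closedNbhd _ _))
    have huc := contractMap_of_ne hne hu
    refine ⟨u, ⟨?_, fun hm => huP (huc ▸ ih ⟨u, hm, rfl⟩)⟩, huc⟩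
    rw [contractMap_of_ne hne hvy] at huN
    rcases huN with he | ha
    · exact Or.inl (congrArg Subtype.val he)
    · right
      rw [SimpleGraph.mem_neighborSet, contractEdge, SimpleGraph.fromRel_adj] at ha
      rw [SimpleGraph.mem_neighborSet]
      have := fun hh : G.Adj u v => hh.symm
      grind

theorem propRad_edge_contraction_increase {V : Type*} [Fintype V] [DecidableEq V]
    (G : SimpleGraph V) (k : ℕ) (hk : 0 < k) (x y : V) (hxy : G.Adj x y)
    (h : pdn (contractEdge G x y) k = pdn G k + 1) :
    propRad (contractEdge G x y) k ≤ propRad G k := by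
  obtain ⟨S, hS, hc, hr⟩ := exists_isPDS_radPDS_eq_propRad G k
  set T := insert (⟨x, hxy.ne⟩ : {u : V // u ≠ y}) (contractMap hxy.ne '' S)
  have hT : ∀ i, monitored G k S i = Set.univ →
      monitored (contractEdge G x y) k T i = Set.univ := fun i hi =>
    Set.eq_univ_of_forall fun u => contractMap_image_monitored_subset G k hxy.ne S i
      ⟨u, hi ▸ Set.mem_univ _, contractMap_of_ne hxy.ne u.2⟩
  have hTP : IsPDS (contractEdge G x y) k T := hS.imp hT
  have hTc : T.ncard = pdn (contractEdge G x y) k := by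
    refine le_antisymm ?_ (pdn_le_ncard hTP)
    rw [h, ← hc]
    exact (Set.ncard_insert_le _ _).trans
      (Nat.add_le_add_right (Set.ncard_image_le (Set.toFinite S)) 1)
  rw [← hr]
  refine (Nat.sInf_le ⟨T, hTP, hTc, rfl⟩ : propRad (contractEdge G x y) k ≤ _).trans ?_
  exact Nat.add_le_add_left (Nat.sInf_le (hT _ (Nat.sInf_mem hS))) 1
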